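/- Let 𝒯 be any finite set of positive-definite binary integer-matrix forms, none of which is equivalent to ⟨2,3⟩ = 2x² + 3y². Then there exists a positive-definite integer-matrix lattice that represents every form in 𝒯 but does not represent ⟨2,3⟩. -/

import Mathlib

open Matrix

/-- `G` (Gram matrix of a `ℤ`-lattice) represents the quadratic form with Gram matrix `q`:
there is a `ℤ`-linear injection preserving the bilinear forms. -/
def Represents {ι κ : Type*} [Fintype ι] [Fintype κ]
    (G : Matrix ι ι ℤ) (q : Matrix κ κ ℤ) : Prop :=
  ∃ S : Matrix ι κ ℤ, Function.Injective S.mulVec ∧ Sᵀ * G * S = q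

/-- A symmetric positive-definite integer Gram matrix. -/
def IsPosDefForm {ι : Type*} [Fintype ι] (G : Matrix ι ι ℤ) : Prop :=
  G.IsSymm ∧ ∀ x : ι → ℤ, x ≠ 0 → 0 < x ⬝ᵥ G.mulVec x

/-- The binary form `[a,b,c] = a x² + 2 b x y + c y²` with Gram matrix `((a,b),(b,c))`. -/
def bin (a b c : ℤ) : Matrix (Fin 2) (Fin 2) ℤ := !![a, b; b, c]


/-- Two binary forms are equivalent if their Gram matrices are `GL₂(ℤ)`-equivalent. -/
def EquivForm (q q' : Matrix (Fin 2) (Fin 2) ℤ) : Prop :=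
  ∃ U : Matrix (Fin 2) (Fin 2) ℤ, IsUnit U.det ∧ Uᵀ * q * U = q'

section Basic

variable {ι κ : Type*} [Fintype ι] [Fintype κ]

theorem injective_mulVec_of_transpose_mul_mul {G : Matrix ι ι ℤ} {q : Matrix κ κ ℤ}
    (hq : IsPosDefForm q) {S : Matrix ι κ ℤ} (hS : Sᵀ * G * S = q) :
    Function.Injective S.mulVec := by
  intro x y hxy
  by_contra hne
  have h := hq.2 (x - y) (sub_ne_zero.mpr hne)
  have h0 : S *ᵥ (x - y) = 0 := by
    rw [mulVec_sub, sub_eq_zero]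
    exact hxy
  rw [← hS, ← mulVec_mulVec, h0] at h
  simp at h

theorem Represents.of_transpose_mul_mul {G : Matrix ι ι ℤ} {q : Matrix κ κ ℤ}
    (hq : IsPosDefForm q) (S : Matrix ι κ ℤ) (hS : Sᵀ * G * S = q) : Represents G q :=
  ⟨S, injective_mulVec_of_transpose_mul_mul hq hS, hS⟩

theorem Represents.of_submatrix [DecidableEq ι] {μ : Type*} [Fintype μ] {G : Matrix ι ι ℤ}
    {q : Matrix κ κ ℤ} (hq : IsPosDefForm q) (f : μ → ι) (h : Represents (G.submatrix f f) q) :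
    Represents G q := by
  obtain ⟨S, -, hS⟩ := h
  refine .of_transpose_mul_mul hq ((1 : Matrix ι ι ℤ).submatrix id f * S) ?_
  rw [← hS]
  have h : ((1 : Matrix ι ι ℤ).submatrix id f)ᵀ * G * (1 : Matrix ι ι ℤ).submatrix id f
      = G.submatrix f f := by
    ext i j
    simp [Matrix.mul_apply, Matrix.one_apply]
  rw [← h, transpose_mul]
  simp only [Matrix.mul_assoc]

theorem IsPosDefForm.submatrix_equiv {G : Matrix ι ι ℤ} (hG : IsPosDefForm G) (e : κ ≃ ι) :
    IsPosDefForm (G.submatrix e e) := by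
  refine ⟨hG.1.submatrix e, fun x hx => ?_⟩
  have h := hG.2 (x ∘ e.symm) fun h0 => hx <| by
    ext i
    simpa using congrFun h0 (e i)
  rw [submatrix_mulVec_equiv, ← comp_equiv_symm_dotProduct]
  exact h

theorem IsPosDefForm.of_four_le {G : Matrix ι ι ℤ} (hs : G.IsSymm)
    (h : ∀ x, x ≠ 0 → 4 ≤ x ⬝ᵥ G *ᵥ x) : IsPosDefForm G :=
  ⟨hs, fun x hx => by linarith [h x hx]⟩

end Basic

section Reduction

theorem EquivForm.trans {q₁ q₂ q₃ : Matrix (Fin 2) (Fin 2) ℤ} (h₁ : EquivForm q₁ q₂)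
    (h₂ : EquivForm q₂ q₃) : EquivForm q₁ q₃ := by
  obtain ⟨U, hU, rfl⟩ := h₁
  obtain ⟨V, hV, rfl⟩ := h₂
  refine ⟨U * V, by rw [det_mul]; exact hU.mul hV, ?_⟩
  simp only [transpose_mul, Matrix.mul_assoc]

theorem EquivForm.refl (q : Matrix (Fin 2) (Fin 2) ℤ) : EquivForm q q :=
  ⟨1, by simp, by simp⟩

theorem EquivForm.symm {q₁ q₂ : Matrix (Fin 2) (Fin 2) ℤ} (h : EquivForm q₁ q₂) :
    EquivForm q₂ q₁ := by
  obtain ⟨U, hU, rfl⟩ := h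
  refine ⟨U⁻¹, by simpa using hU, ?_⟩
  have h₁ : U * U⁻¹ = 1 := mul_nonsing_inv U hU
  calc (U⁻¹)ᵀ * (Uᵀ * q₁ * U) * U⁻¹ = (U * U⁻¹)ᵀ * q₁ * (U * U⁻¹) := by
        simp only [transpose_mul, Matrix.mul_assoc]
    _ = q₁ := by simp [h₁]

theorem EquivForm.isPosDefForm {q₁ q₂ : Matrix (Fin 2) (Fin 2) ℤ} (h : EquivForm q₁ q₂)
    (hq : IsPosDefForm q₁) : IsPosDefForm q₂ := by
  obtain ⟨U, hU, rfl⟩ := h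
  refine ⟨?_, fun x hx => ?_⟩
  · simp only [IsSymm, transpose_mul, transpose_transpose, hq.1.eq, Matrix.mul_assoc]
  · have h := hq.2 (U *ᵥ x) fun h0 => hx <| by
      rw [← one_mulVec x, ← nonsing_inv_mul U hU, ← mulVec_mulVec, h0, mulVec_zero]
    rwa [← mulVec_mulVec, ← mulVec_mulVec, dotProduct_mulVec, vecMul_transpose]

theorem Represents.of_equivForm {ι : Type*} [Fintype ι] {G : Matrix ι ι ℤ}
    {q₁ q₂ : Matrix (Fin 2) (Fin 2) ℤ} (hq : IsPosDefForm q₁) (h : EquivForm q₁ q₂)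
    (hG : Represents G q₂) : Represents G q₁ := by
  obtain ⟨U, -, hU⟩ := h.symm
  obtain ⟨S, -, rfl⟩ := hG
  refine .of_transpose_mul_mul hq (S * U) ?_
  rw [← hU]
  simp only [transpose_mul, Matrix.mul_assoc]

theorem dotProduct_bin_mulVec (a b c : ℤ) (x : Fin 2 → ℤ) :
    x ⬝ᵥ bin a b c *ᵥ x = a * x 0 ^ 2 + 2 * b * (x 0 * x 1) + c * x 1 ^ 2 := by
  simp [bin, dotProduct, mulVec, Fin.sum_univ_two]
  ring

theorem isSymm_bin (a b c : ℤ) : (bin a b c).IsSymm := by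
  ext i j
  fin_cases i <;> fin_cases j <;> rfl

theorem IsPosDefForm.pos_of_bin {a b c : ℤ} (h : IsPosDefForm (bin a b c)) : 0 < a ∧ 0 < c := by
  have h₁ := h.2 ![1, 0] (by simp)
  have h₂ := h.2 ![0, 1] (by simp)
  rw [dotProduct_bin_mulVec] at h₁ h₂
  exact ⟨by simpa using h₁, by simpa using h₂⟩

theorem equivForm_bin_swap (a b c : ℤ) : EquivForm (bin a b c) (bin c b a) := by
  refine ⟨!![0, 1; 1, 0], by simp [det_fin_two], ?_⟩
  ext i j
  fin_cases i <;> fin_cases j <;> simp [bin, Matrix.mul_apply, Fin.sum_univ_two]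

theorem equivForm_bin_neg (a b c : ℤ) : EquivForm (bin a b c) (bin a (-b) c) := by
  refine ⟨!![1, 0; 0, -1], by simp [det_fin_two], ?_⟩
  ext i j
  fin_cases i <;> fin_cases j <;> simp [bin, Matrix.mul_apply, Fin.sum_univ_two]

theorem equivForm_bin_shear (a b c t : ℤ) :
    EquivForm (bin a b c) (bin a (b + t * a) (c + 2 * t * b + t ^ 2 * a)) := by
  refine ⟨!![1, t; 0, 1], by simp [det_fin_two], ?_⟩
  ext i j
  fin_cases i <;> fin_cases j <;> simp [bin, Matrix.mul_apply, Fin.sum_univ_two] <;> ring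

theorem exists_equivForm_bin_abs_le (a b c : ℤ) (h : IsPosDefForm (bin a b c)) :
    ∃ a' b' c', EquivForm (bin a b c) (bin a' b' c') ∧ |2 * b'| ≤ a' ∧ |2 * b'| ≤ c' := by
  induction hn : (a + c).toNat using Nat.strong_induction_on generalizing a b c with
  | _ n ih =>
    have step : ∀ a' b' c', EquivForm (bin a b c) (bin a' b' c') → a' + c' < a + c →
        ∃ a' b' c', EquivForm (bin a b c) (bin a' b' c') ∧ |2 * b'| ≤ a' ∧ |2 * b'| ≤ c' := by
      intro a' b' c' he hlt
      have h' := he.isPosDefForm h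
      have hp := h'.pos_of_bin
      obtain ⟨x, y, z, he', hxyz⟩ := ih (a' + c').toNat (by omega) a' b' c' h' rfl
      exact ⟨x, y, z, he.trans he', hxyz⟩
    by_cases h₁ : |2 * b| ≤ a
    · by_cases h₂ : |2 * b| ≤ c
      · exact ⟨a, b, c, .refl _, h₁, h₂⟩
      · rcases lt_max_iff.mp (not_le.mp h₂) with h₂ | h₂
        · exact step _ _ _ ((equivForm_bin_swap a b c).trans (equivForm_bin_shear c b a (-1)))
            (by linarith)
        · exact step _ _ _ ((equivForm_bin_swap a b c).trans (equivForm_bin_shear c b a 1))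
            (by linarith)
    · rcases lt_max_iff.mp (not_le.mp h₁) with h₁ | h₁
      · exact step _ _ _ (equivForm_bin_shear a b c (-1)) (by linarith)
      · exact step _ _ _ (equivForm_bin_shear a b c 1) (by linarith)

/-- Every positive-definite binary form is equivalent to a Minkowski-reduced one. -/
theorem exists_equivForm_bin_reduced {q : Matrix (Fin 2) (Fin 2) ℤ} (hq : IsPosDefForm q) :
    ∃ a b c, EquivForm q (bin a b c) ∧ 0 ≤ b ∧ 2 * b ≤ a ∧ a ≤ c := by
  have hbin : q = bin (q 0 0) (q 0 1) (q 1 1) := by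
    ext i j
    fin_cases i <;> fin_cases j <;> simp [bin, hq.1.apply 0 1]
  obtain ⟨a, b, c, he, ha, hc⟩ := exists_equivForm_bin_abs_le _ _ _ (hbin ▸ hq)
  rw [← hbin] at he
  have habs : EquivForm q (bin a |b| c) := by
    rcases abs_choice b with h | h <;> rw [h]
    · exact he
    · exact he.trans (equivForm_bin_neg a b c)
  rw [abs_mul, abs_two] at ha hc
  rcases le_total a c with hac | hac
  · exact ⟨a, |b|, c, habs, abs_nonneg b, ha, hac⟩
  · exact ⟨c, |b|, a, habs.trans (equivForm_bin_swap _ _ _), abs_nonneg b, hc, hac⟩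

theorem four_le_of_reduced {a b c : ℤ} (hb : 0 ≤ b) (hab : 2 * b ≤ a) (hac : a ≤ c) (ha : 4 ≤ a)
    (x : Fin 2 → ℤ) (hx : x ≠ 0) : 4 ≤ x ⬝ᵥ bin a b c *ᵥ x := by
  rw [dotProduct_bin_mulVec]
  have hpos : 1 ≤ x 0 ^ 2 - |x 0 * x 1| + x 1 ^ 2 := by
    rw [abs_mul, ← sq_abs (x 0), ← sq_abs (x 1)]
    have hx' : 0 < |x 0| ∨ 0 < |x 1| := by
      simp only [abs_pos]
      by_contra! h
      exact hx (by ext i; fin_cases i <;> simp [h.1, h.2])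
    have h₀ := abs_nonneg (x 0)
    have h₁ := abs_nonneg (x 1)
    rcases hx' with h | h <;> nlinarith [sq_nonneg (|x 0| - |x 1|), mul_nonneg h₀ h₁]
  have hcross : -(a * |x 0 * x 1|) ≤ 2 * b * (x 0 * x 1) := by
    nlinarith [neg_abs_le (x 0 * x 1), abs_nonneg (x 0 * x 1)]
  nlinarith [mul_le_mul_of_nonneg_right hac (sq_nonneg (x 1))]

end Reduction

section Core

/-- The Gram matrix of `ℤ² ⊥ A₂`. -/
def coreGram : Matrix (Fin 4) (Fin 4) ℤ :=
  !![1, 0, 0, 0; 0, 1, 0, 0; 0, 0, 2, 1; 0, 0, 1, 2]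

theorem isSymm_coreGram : coreGram.IsSymm := by
  unfold coreGram IsSymm
  decide

theorem dotProduct_coreGram_mulVec (x y : Fin 4 → ℤ) :
    x ⬝ᵥ coreGram *ᵥ y = x 0 * y 0 + x 1 * y 1
      + (2 * (x 2 * y 2) + x 2 * y 3 + x 3 * y 2 + 2 * (x 3 * y 3)) := by
  simp [coreGram, dotProduct, mulVec, Fin.sum_univ_four]
  ring

theorem isPosDefForm_coreGram : IsPosDefForm coreGram := by
  refine ⟨isSymm_coreGram, fun x hx => ?_⟩
  rw [dotProduct_coreGram_mulVec]
  by_contra! h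
  refine hx ?_
  have h₀ : x 0 = 0 := by nlinarith [sq_nonneg (x 2 + x 3)]
  have h₁ : x 1 = 0 := by nlinarith [sq_nonneg (x 2 + x 3)]
  have h₂ : x 2 = 0 := by nlinarith [sq_nonneg (x 2 + x 3)]
  have h₃ : x 3 = 0 := by nlinarith [sq_nonneg (x 2 + x 3)]
  ext i
  fin_cases i <;> simp [h₀, h₁, h₂, h₃]

theorem dotProduct_coreGram_mulVec_ne_zero {u v : Fin 4 → ℤ} (hu : u ⬝ᵥ coreGram *ᵥ u = 2)
    (hv : v ⬝ᵥ coreGram *ᵥ v = 3) : u ⬝ᵥ coreGram *ᵥ v ≠ 0 := by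
  intro huv
  rw [dotProduct_coreGram_mulVec] at hu hv huv
  generalize u 0 = a, u 1 = b, u 2 = c, u 3 = d, v 0 = a', v 1 = b', v 2 = c', v 3 = d' at *
  obtain ⟨N, hN⟩ : ∃ N, N = c * c + c * d + d * d := ⟨_, rfl⟩
  obtain ⟨N', hN'⟩ : ∃ N', N' = c' * c' + c' * d' + d' * d' := ⟨_, rfl⟩
  obtain ⟨B, hB⟩ : ∃ B, B = 2 * (c * c') + c * d' + d * c' + 2 * (d * d') := ⟨_, rfl⟩
  obtain ⟨D, hD⟩ : ∃ D, D = c * d' - d * c' := ⟨_, rfl⟩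
  have hu' : a * a + b * b + 2 * N = 2 := by rw [hN]; linarith
  have hv' : a' * a' + b' * b' + 2 * N' = 3 := by rw [hN']; linarith
  have hBD : 4 * (N * N') = B ^ 2 + 3 * D ^ 2 := by rw [hN, hN', hB, hD]; ring
  have hN₀ : 0 ≤ N := by nlinarith [sq_nonneg (c + d), sq_nonneg c, sq_nonneg d]
  have hN₀' : 0 ≤ N' := by nlinarith [sq_nonneg (c' + d'), sq_nonneg c', sq_nonneg d']
  rw [← hB] at huv
  clear hN hN' hB hD hu hv
  have ha := mul_self_nonneg a
  have hb := mul_self_nonneg b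
  have ha' := mul_self_nonneg a'
  have hb' := mul_self_nonneg b'
  have hD₀ := sq_nonneg D
  have hN₁ : N = 0 ∨ N = 1 := by omega
  rcases hN₁ with rfl | rfl
  · have hB₀ : B = 0 := by nlinarith
    have hb₁ : b * b = 1 := by
      have : a ≤ 1 := by nlinarith
      have : -1 ≤ a := by nlinarith
      have : b ≤ 1 := by nlinarith
      have : -1 ≤ b := by nlinarith
      clear huv hv' hBD
      interval_cases a <;> interval_cases b <;> omega
    have ha₁ : a * a = 1 := by omega
    have hab : a' * a' = b' * b' := by
      linear_combination (-a' * a') * ha₁ + b' * b' * hb₁ + (a * a' - b * b') * (huv - hB₀)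
    omega
  · have ha₀ : a = 0 := by nlinarith
    have hb₀ : b = 0 := by nlinarith
    have hB₀ : B = 0 := by simpa [ha₀, hb₀] using huv
    rw [hB₀] at hBD
    have hN₁' : N' = 0 := by omega
    have : a' ≤ 1 := by nlinarith
    have : -1 ≤ a' := by nlinarith
    have : b' ≤ 1 := by nlinarith
    have : -1 ≤ b' := by nlinarith
    clear huv hu' hBD
    interval_cases a' <;> interval_cases b' <;> omega

end Core

section OrthogonalSum

theorem dotProduct_fromBlocks_mulVec {ι κ : Type*} [Fintype ι] [Fintype κ] (G : Matrix ι ι ℤ)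
    (H : Matrix κ κ ℤ) (x y : ι ⊕ κ → ℤ) :
    x ⬝ᵥ fromBlocks G 0 0 H *ᵥ y = (x ∘ Sum.inl) ⬝ᵥ G *ᵥ (y ∘ Sum.inl)
      + (x ∘ Sum.inr) ⬝ᵥ H *ᵥ (y ∘ Sum.inr) := by
  simp [fromBlocks_mulVec, dotProduct, Fintype.sum_sum_type]

theorem IsPosDefForm.fromBlocks {ι κ : Type*} [Fintype ι] [Fintype κ] {G : Matrix ι ι ℤ}
    {H : Matrix κ κ ℤ} (hG : IsPosDefForm G) (hH : IsPosDefForm H) :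
    IsPosDefForm (fromBlocks G 0 0 H) := by
  refine ⟨hG.1.fromBlocks (by simp) hH.1, fun x hx => ?_⟩
  rw [dotProduct_fromBlocks_mulVec]
  have hG' : 0 ≤ (x ∘ Sum.inl) ⬝ᵥ G *ᵥ (x ∘ Sum.inl) := by
    by_cases h : x ∘ Sum.inl = 0
    · simp [h]
    · exact (hG.2 _ h).le
  by_cases h : x ∘ Sum.inr = 0
  · have h' : x ∘ Sum.inl ≠ 0 := fun h' => hx <| by
      ext (i | i)
      · exact congrFun h' i
      · exact congrFun h i
    have := hG.2 _ h'
    simpa [h] using this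
  · linarith [hH.2 _ h]

theorem dotProduct_blockDiagonal_mulVec {o κ : Type*} [Fintype o] [DecidableEq o] [Fintype κ]
    (M : o → Matrix κ κ ℤ) (x : κ × o → ℤ) :
    x ⬝ᵥ blockDiagonal M *ᵥ x = ∑ t, (fun i => x (i, t)) ⬝ᵥ M t *ᵥ (fun i => x (i, t)) := by
  simp only [dotProduct, mulVec, Fintype.sum_prod_type, blockDiagonal_apply, ite_mul, zero_mul]
  rw [Finset.sum_comm]
  simp

theorem four_le_blockDiagonal {o κ : Type*} [Fintype o] [DecidableEq o] [Fintype κ]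
    {M : o → Matrix κ κ ℤ} (hM : ∀ t x, x ≠ 0 → 4 ≤ x ⬝ᵥ M t *ᵥ x) (x : κ × o → ℤ) (hx : x ≠ 0) :
    4 ≤ x ⬝ᵥ blockDiagonal M *ᵥ x := by
  rw [dotProduct_blockDiagonal_mulVec]
  obtain ⟨⟨i, t⟩, hit⟩ := Function.ne_iff.mp hx
  refine (hM t (fun i => x (i, t)) fun h => hit (congrFun h i)).trans ?_
  refine Finset.single_le_sum (f := fun t => (fun i => x (i, t)) ⬝ᵥ M t *ᵥ (fun i => x (i, t)))
    (fun s _ => ?_) (Finset.mem_univ t)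
  by_cases h : (fun i => x (i, s)) = 0
  · simp [h]
  · linarith [hM s _ h]

theorem represents_fromBlocks {ι κ μ : Type*} [Fintype ι] [Fintype κ] [Fintype μ]
    {G : Matrix ι ι ℤ} {H : Matrix κ κ ℤ} {q : Matrix μ μ ℤ} (hq : IsPosDefForm q)
    (S : Matrix ι μ ℤ) (R : Matrix κ μ ℤ) (h : Sᵀ * G * S + Rᵀ * H * R = q) :
    Represents (fromBlocks G 0 0 H) q := by
  refine .of_transpose_mul_mul hq (fromRows S R) ?_
  rw [transpose_fromRows, Matrix.mul_assoc, fromBlocks_mul_fromRows, fromCols_mul_fromRows, ← h]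
  simp [Matrix.mul_assoc]

/-- An orthogonal sum of `ℤ² ⊥ A₂` with a lattice of minimum at least `4` does not represent
`⟨2,3⟩`. -/
theorem not_represents_two_three {κ : Type*} [Fintype κ] {H : Matrix κ κ ℤ}
    (hH : ∀ x, x ≠ 0 → 4 ≤ x ⬝ᵥ H *ᵥ x) :
    ¬ Represents (fromBlocks coreGram 0 0 H) (bin 2 0 3) := by
  rintro ⟨S, -, hS⟩
  have entry : ∀ i j, (S.col i) ⬝ᵥ fromBlocks coreGram 0 0 H *ᵥ (S.col j) = bin 2 0 3 i j := by
    intro i j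
    rw [← hS, Matrix.mul_assoc, Matrix.mul_apply]
    rfl
  have vanish : ∀ x : Fin 4 ⊕ κ → ℤ, x ⬝ᵥ fromBlocks coreGram 0 0 H *ᵥ x ≤ 3 →
      x ∘ Sum.inr = 0 := by
    intro x hx
    by_contra h
    rw [dotProduct_fromBlocks_mulVec] at hx
    have h₁ := hH _ h
    by_cases h₂ : x ∘ Sum.inl = 0
    · simp only [h₂, zero_dotProduct] at hx
      linarith
    · linarith [isPosDefForm_coreGram.2 _ h₂]
  have hu := entry 0 0
  have hv := entry 1 1
  have huv := entry 0 1
  have hu₀ := vanish _ (hu.trans_le (by simp [bin]))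
  have hv₀ := vanish _ (hv.trans_le (by simp [bin]))
  rw [dotProduct_fromBlocks_mulVec] at hu hv huv
  rw [hu₀] at hu huv
  rw [hv₀] at hv
  refine dotProduct_coreGram_mulVec_ne_zero (u := S.col 0 ∘ Sum.inl) (v := S.col 1 ∘ Sum.inl)
    ?_ ?_ ?_
  · simpa [bin] using hu
  · simpa [bin] using hv
  · simpa [bin] using huv

theorem represents_fromBlocks_bin {ι : Type*} [Fintype ι] {G : Matrix ι ι ℤ} (hG : G.IsSymm)
    {p k a b c : ℤ} (hq : IsPosDefForm (bin a b c)) (u v : ι → ℤ) (m : ℤ)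
    (ha : u ⬝ᵥ G *ᵥ u = a) (hb : u ⬝ᵥ G *ᵥ v = b) (hc : v ⬝ᵥ G *ᵥ v + m ^ 2 * k = c) :
    Represents (fromBlocks G 0 0 (bin p 0 k)) (bin a b c) := by
  refine represents_fromBlocks hq (of ![u, v])ᵀ !![0, 0; 0, m] ?_
  have hb' : v ⬝ᵥ G *ᵥ u = b := by
    rw [← hb, dotProduct_comm, ← vecMul_transpose, hG.eq, dotProduct_mulVec]
  have key : ∀ i j, (((of ![u, v])ᵀ)ᵀ * G * (of ![u, v])ᵀ) i j
      = ![u, v] i ⬝ᵥ G *ᵥ ![u, v] j := by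
    intro i j
    rw [Matrix.mul_assoc]
    rfl
  ext i j
  rw [Matrix.add_apply, key]
  fin_cases i <;> fin_cases j <;>
    simp [bin, Matrix.mul_apply, Fin.sum_univ_two, ha, hb, hb', ← hc]
  ring

/-- A reduced binary form other than `⟨2,3⟩` is represented by the orthogonal sum of `ℤ² ⊥ A₂`
with a binary lattice of minimum at least `4`. -/
theorem exists_four_le_represents_of_reduced {a b c : ℤ} (hq : IsPosDefForm (bin a b c))
    (hb : 0 ≤ b) (hab : 2 * b ≤ a) (hac : a ≤ c) (hne : bin a b c ≠ bin 2 0 3) :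
    ∃ H : Matrix (Fin 2) (Fin 2) ℤ, H.IsSymm ∧ (∀ x, x ≠ 0 → 4 ≤ x ⬝ᵥ H *ᵥ x) ∧
      Represents (fromBlocks coreGram 0 0 H) (bin a b c) := by
  rcases le_or_gt 4 a with ha | ha
  · exact ⟨bin a b c, isSymm_bin a b c, four_le_of_reduced hb hab hac ha,
      represents_fromBlocks hq 0 1 (by simp)⟩
  have of_vectors : ∀ (u v : Fin 4 → ℤ) (m k : ℤ), 4 ≤ k → u ⬝ᵥ coreGram *ᵥ u = a →
      u ⬝ᵥ coreGram *ᵥ v = b → v ⬝ᵥ coreGram *ᵥ v + m ^ 2 * k = c →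
      ∃ H : Matrix (Fin 2) (Fin 2) ℤ, H.IsSymm ∧ (∀ x, x ≠ 0 → 4 ≤ x ⬝ᵥ H *ᵥ x) ∧
        Represents (fromBlocks coreGram 0 0 H) (bin a b c) := fun u v m k hk hu huv hv =>
    ⟨bin 4 0 k, isSymm_bin 4 0 k, four_le_of_reduced le_rfl (by norm_num) hk le_rfl,
      represents_fromBlocks_bin isSymm_coreGram hq u v m hu huv hv⟩
  simp only [dotProduct_coreGram_mulVec] at of_vectors
  have inside : ∀ u v : Fin 4 → ℤ, _ → _ → _ → _ :=
    fun u v hu huv hv => of_vectors u v 0 4 le_rfl hu huv (by simpa using hv)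
  have outside : ∀ u v : Fin 4 → ℤ, _ → _ → _ → _ :=
    fun u v hk hu huv => of_vectors u v 1 _ hk hu huv (by rw [one_pow, one_mul, add_sub_cancel])
  have ha₀ := hq.pos_of_bin.1
  obtain rfl | rfl | rfl : a = 1 ∨ a = 2 ∨ a = 3 := by omega
  · obtain rfl : b = 0 := by omega
    obtain rfl | rfl | rfl | hc : c = 1 ∨ c = 2 ∨ c = 3 ∨ 4 ≤ c := by omega
    · exact inside ![1, 0, 0, 0] ![0, 1, 0, 0] (by simp) (by simp) (by simp)
    · exact inside ![1, 0, 0, 0] ![0, 0, 1, 0] (by simp) (by simp) (by simp)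
    · exact inside ![1, 0, 0, 0] ![0, 1, 1, 0] (by simp) (by simp) (by simp)
    · exact outside ![1, 0, 0, 0] ![0, 0, 0, 0] (by simpa using hc) (by simp) (by simp)
  · obtain rfl | rfl : b = 0 ∨ b = 1 := by omega
    · obtain rfl | rfl | hc : c = 2 ∨ c = 3 ∨ 4 ≤ c := by omega
      · exact inside ![1, 1, 0, 0] ![1, -1, 0, 0] (by simp) (by simp) (by simp)
      · exact absurd rfl hne
      · exact outside ![0, 0, 1, 0] ![0, 0, 0, 0] (by simpa using hc) (by simp) (by simp)
    · obtain rfl | rfl | rfl | hc : c = 2 ∨ c = 3 ∨ c = 4 ∨ 5 ≤ c := by omega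
      · exact inside ![0, 0, 1, 0] ![0, 0, 0, 1] (by simp) (by simp) (by simp)
      · exact inside ![0, 0, 1, 0] ![1, 0, 0, 1] (by simp) (by simp) (by simp)
      · exact inside ![0, 0, 1, 0] ![1, 1, 0, 1] (by simp) (by simp) (by simp)
      · exact outside ![1, 1, 0, 0] ![1, 0, 0, 0] (by simp; omega) (by simp) (by simp)
  · obtain rfl | rfl : b = 0 ∨ b = 1 := by omega
    · obtain rfl | hc : c = 3 ∨ 4 ≤ c := by omega
      · exact inside ![1, 0, 1, 0] ![1, 0, 0, -1] (by simp) (by simp) (by simp)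
      · exact outside ![1, 0, 1, 0] ![0, 0, 0, 0] (by simpa using hc) (by simp) (by simp)
    · obtain rfl | rfl | hc : c = 3 ∨ c = 4 ∨ 5 ≤ c := by omega
      · exact inside ![1, 0, 1, 0] ![0, 1, 0, 1] (by simp) (by simp) (by simp)
      · exact inside ![1, 0, 1, 0] ![-1, 1, 1, 0] (by simp) (by simp) (by simp)
      · exact outside ![1, 0, 1, 0] ![1, 0, 0, 0] (by simp; omega) (by simp) (by simp)

theorem exists_four_le_represents {q : Matrix (Fin 2) (Fin 2) ℤ} (hq : IsPosDefForm q)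
    (hne : ¬ EquivForm q (bin 2 0 3)) :
    ∃ H : Matrix (Fin 2) (Fin 2) ℤ, H.IsSymm ∧ (∀ x, x ≠ 0 → 4 ≤ x ⬝ᵥ H *ᵥ x) ∧
      Represents (fromBlocks coreGram 0 0 H) q := by
  obtain ⟨a, b, c, he, hb, hab, hac⟩ := exists_equivForm_bin_reduced hq
  obtain ⟨H, hs, hH, hr⟩ := exists_four_le_represents_of_reduced (he.isPosDefForm hq) hb hab hac
    fun h => hne (h ▸ he)
  exact ⟨H, hs, hH, hr.of_equivForm hq he⟩

end OrthogonalSum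

/-- if `𝒯` is a finite set of positive-definite binary forms none of which
is equivalent to `⟨2,3⟩`, then some positive-definite lattice represents all of `𝒯` but
not `⟨2,3⟩`. -/
theorem exists_lattice_truant_two_three (T : Finset (Matrix (Fin 2) (Fin 2) ℤ))
    (hpd : ∀ q ∈ T, IsPosDefForm q)
    (hne : ∀ q ∈ T, ¬ EquivForm q (bin 2 0 3)) :
    ∃ (n : ℕ) (L : Matrix (Fin n) (Fin n) ℤ), IsPosDefForm L ∧
      (∀ q ∈ T, Represents L q) ∧ ¬ Represents L (bin 2 0 3) := by
  classical
  choose M hMs hM hMr using fun q : T => exists_four_le_represents (hpd q q.2) (hne q q.2)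
  set L := fromBlocks coreGram 0 0 (blockDiagonal M) with hL
  have hmin := four_le_blockDiagonal hM
  have hsymm : (blockDiagonal M).IsSymm := by
    simp only [IsSymm, blockDiagonal_transpose, (hMs _).eq]
  have hpos : IsPosDefForm L := isPosDefForm_coreGram.fromBlocks (.of_four_le hsymm hmin)
  have hbin : IsPosDefForm (bin 2 0 3) := by
    refine ⟨isSymm_bin 2 0 3, fun x hx => ?_⟩
    rw [dotProduct_bin_mulVec]
    by_contra! h
    have h₀ : x 0 = 0 := by nlinarith
    have h₁ : x 1 = 0 := by nlinarith
    exact hx (by ext i; fin_cases i <;> simp [h₀, h₁])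
  let e := (Fintype.equivFin (Fin 4 ⊕ Fin 2 × T)).symm
  refine ⟨_, L.submatrix e e, hpos.submatrix_equiv e, fun q hq => ?_, fun h => ?_⟩
  · refine .of_submatrix (hpd q hq) e.symm ?_
    refine .of_submatrix (hpd q hq) (Sum.map id fun i => (i, ⟨q, hq⟩)) ?_
    convert hMr ⟨q, hq⟩ using 1
    ext (i | i) (j | j) <;> simp [hL, blockDiagonal_apply]
  · exact not_represents_two_three hmin (.of_submatrix hbin e h)
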